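/- Let ω₀ = T_{0,0} and let N₀ be the multiplicative order of the matrix ω₀^{−1}·T. Then N₀ divides N, the integer e = N/N₀ divides 12, and the greatest common divisor of e and N₀ is either 1 or 2. -/

import Mathlib

open Matrix Complex

abbrev SL2Z := Matrix.SpecialLinearGroup (Fin 2) ℤ

def sM : SL2Z := ⟨!![0, -1; 1, 0], by norm_num [Matrix.det_fin_two_of]⟩
def tM : SL2Z := ⟨!![1, 1; 0, 1], by norm_num [Matrix.det_fin_two_of]⟩

/-- A ring automorphism of a subfield extends to any algebraically closed extension. -/
theorem IsAlgClosed.exists_ringHom_extending {F K : Type*} [Field F] [Field K] [Algebra F K]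
    [IsAlgClosed K] (τ : F ≃+* F) :
    ∃ σ : K →+* K, ∀ x : F, σ (algebraMap F K x) = algebraMap F K (τ x) := by
  obtain ⟨s, hs⟩ := exists_isTranscendenceBasis F K
  let _ := IsAlgClosed.isAlgClosure_of_transcendence_basis _ hs
  let A := Algebra.adjoin F (Set.range ((↑) : s → K))
  let e : A ≃+* A := (hs.1.aevalEquiv.symm.toRingEquiv.trans (MvPolynomial.mapEquiv s τ)).trans
    hs.1.aevalEquiv.toRingEquiv
  refine ⟨(IsAlgClosure.equivOfEquiv K K e : K →+* K), fun x => ?_⟩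
  have he : e (algebraMap F A x) = algebraMap F A (τ x) := by
    have h : hs.1.aevalEquiv.symm (algebraMap F A x) = MvPolynomial.C x := by
      simp [A, MvPolynomial.algebraMap_eq]
    have h' : hs.1.aevalEquiv (MvPolynomial.C (τ x)) = algebraMap F A (τ x) := by
      rw [← MvPolynomial.algebraMap_eq]; exact hs.1.aevalEquiv.commutes _
    change hs.1.aevalEquiv (MvPolynomial.mapEquiv s τ (hs.1.aevalEquiv.symm _)) = _
    rw [h, ← h']
    simp
  have := IsAlgClosure.equivOfEquiv_algebraMap K K e (algebraMap F A x)
  rw [he] at this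
  exact this

/-- Every power map on `n`-th roots of unity with exponent coprime to `n` is induced by a ring
endomorphism of the ambient algebraically closed field. -/
theorem IsPrimitiveRoot.exists_ringHom_apply_eq_pow {K : Type*} [Field K] [CharZero K]
    [IsAlgClosed K] {n : ℕ} (hn : 0 < n) {ζ : K} (hζ : IsPrimitiveRoot ζ n) {l : ℕ}
    (hl : l.Coprime n) : ∃ σ : K →+* K, σ ζ = ζ ^ l := by
  have : NeZero n := ⟨hn.ne'⟩
  let F := CyclotomicField n ℚ
  have : IsCyclotomicExtension {n} ℚ F := CyclotomicField.isCyclotomicExtension n ℚ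
  have : IsGalois ℚ F := IsCyclotomicExtension.isGalois {n} ℚ F
  let f : F →ₐ[ℚ] K := IsAlgClosed.lift
  let _ : Algebra F K := f.toRingHom.toAlgebra
  obtain ⟨g, hg⟩ : ∃ g : F, IsPrimitiveRoot g n :=
    ⟨_, IsCyclotomicExtension.zeta_spec n ℚ F⟩
  have hroot : Polynomial.aeval (g ^ l) (minpoly ℚ g) = 0 := by
    rw [← Polynomial.cyclotomic_eq_minpoly_rat hg hn,
      Polynomial.cyclotomic_eq_minpoly_rat (hg.pow_of_coprime l hl) hn]
    exact minpoly.aeval _ _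
  obtain ⟨τ, hτ⟩ := minpoly.exists_algEquiv_of_root' (Algebra.IsAlgebraic.isAlgebraic g) hroot
  obtain ⟨σ, hσ⟩ := IsAlgClosed.exists_ringHom_extending (K := K) τ.toRingEquiv
  have hσg : σ (algebraMap F K g) = algebraMap F K g ^ l := by
    simpa [hτ] using hσ g
  obtain ⟨i, -, hi⟩ :=
    (hg.map_of_injective (algebraMap F K).injective).eq_pow_of_pow_eq_one hζ.pow_eq_one
  exact ⟨σ, by rw [← hi, map_pow, hσg, ← pow_mul, ← pow_mul, mul_comm]⟩

/-- If every unit modulo `n` squares to one modulo `b ∣ n`, then `b ∣ r ^ 2 - 1` for every prime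
`r` not dividing `b`. -/
theorem int_dvd_prime_sq_sub_one_of_forall_coprime {n b r : ℕ} (hn : 0 < n) (hr : r.Prime)
    (h : ∀ l : ℕ, l.Coprime n → (b : ℤ) ∣ (l : ℤ) ^ 2 - 1) (hbn : b ∣ n) (hbr : b.Coprime r) :
    (b : ℤ) ∣ (r : ℤ) ^ 2 - 1 := by
  obtain ⟨a, m, hm, rfl⟩ := Nat.exists_eq_pow_mul_and_not_dvd hn.ne' r hr.ne_one
  have hbm : b ∣ m := (hbr.pow_right a).dvd_of_dvd_mul_left hbn
  have hrm : r.Coprime m := (Nat.Prime.coprime_iff_not_dvd hr).2 hm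
  have hl : (r + m).Coprime (r ^ a * m) :=
    Nat.Coprime.mul_right (Nat.Coprime.pow_right _ (by simpa using hrm.symm)) (by simpa using hrm)
  have h1 := h _ hl
  have h2 : (b : ℤ) ∣ (m : ℤ) * (2 * r + m) := (Int.natCast_dvd_natCast.2 hbm).mul_right _
  have h3 := h1.sub h2
  rwa [show ((r + m : ℕ) : ℤ) ^ 2 - 1 - m * (2 * r + m) = (r : ℤ) ^ 2 - 1 by push_cast; ring] at h3

theorem dvd_twentyFour_of_forall_coprime_sq {n e : ℕ} (hn : 0 < n) (hen : e ∣ n)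
    (h : ∀ l : ℕ, l.Coprime n → (e : ℤ) ∣ (l : ℤ) ^ 2 - 1) : e ∣ 24 := by
  have he : e ≠ 0 := by rintro rfl; exact hn.ne' (zero_dvd_iff.1 hen)
  obtain ⟨a, b, hb, hab⟩ := Nat.exists_eq_pow_mul_and_not_dvd he 2 (by norm_num)
  have key : ∀ c r : ℕ, c ∣ e → r.Prime → c.Coprime r → (c : ℤ) ∣ (r : ℤ) ^ 2 - 1 :=
    fun c r hc hr hcr => int_dvd_prime_sq_sub_one_of_forall_coprime hn hr
      (fun l hl => (Int.natCast_dvd_natCast.2 hc).trans (h l hl)) (hc.trans hen) hcr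
  have h3 : b ∣ 3 := by
    have := key b 2 (hab ▸ dvd_mul_left _ _) Nat.prime_two
      ((Nat.Prime.coprime_iff_not_dvd Nat.prime_two).2 hb).symm
    norm_num at this
    exact_mod_cast this
  have h8 : 2 ^ a ∣ 8 := by
    have := key (2 ^ a) 3 (hab ▸ dvd_mul_right _ _) Nat.prime_three
      (Nat.Coprime.pow_left _ (by norm_num))
    norm_num at this
    exact_mod_cast this
  rw [hab]
  exact mul_dvd_mul h8 h3

theorem coprime_one_add_mul_of_dvd {q a m k M : ℕ} (hq : q ∣ k * M) (hm : m ∣ k) :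
    (1 + k * M).Coprime (q ^ a * m) := by
  refine Nat.Coprime.mul_right (Nat.Coprime.pow_right _ ?_) ?_
  · obtain ⟨c, hc⟩ := hq
    simp [hc]
  · obtain ⟨c, rfl⟩ := hm
    simp [mul_assoc]

/-- The arithmetic constraints on `e` and `M` forced by the vanishing of
`2 * k * (1 + 2 * k' * M)` modulo `e`. -/
theorem dvd_twelve_and_gcd_of_forall_dvd {n e M : ℕ} (hn : 0 < n) (he : e ∣ 24)
    (h : ∀ k : ℕ, (1 + k * M).Coprime n → ∃ k' : ℕ, e ∣ 2 * k * (1 + 2 * k' * M)) :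
    e ∣ 12 ∧ (Nat.gcd e M = 1 ∨ Nat.gcd e M = 2) := by
  have h3 : ¬ (3 ∣ e ∧ 3 ∣ M) := by
    rintro ⟨h3e, h3M⟩
    obtain ⟨a, m, hm, rfl⟩ := Nat.exists_eq_pow_mul_and_not_dvd hn.ne' 3 (by norm_num)
    obtain ⟨k', hk'⟩ := h m (coprime_one_add_mul_of_dvd (h3M.mul_left _) dvd_rfl)
    rcases (Nat.Prime.dvd_mul Nat.prime_three).1 (h3e.trans hk') with h' | h'
    · omega
    · have := (Nat.dvd_add_left (h3M.mul_left (2 * k'))).1 h'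
      omega
  obtain ⟨a, m, hm, rfl⟩ := Nat.exists_eq_pow_mul_and_not_dvd hn.ne' 2 (by norm_num)
  have h4 : ¬ (4 ∣ e ∧ 2 ∣ M) := by
    rintro ⟨h4e, h2M⟩
    obtain ⟨k', hk'⟩ := h m (coprime_one_add_mul_of_dvd (h2M.mul_left _) dvd_rfl)
    have h2 : 2 ∣ m * (1 + 2 * k' * M) := by
      have := h4e.trans hk'
      rw [mul_assoc] at this
      omega
    rcases (Nat.Prime.dvd_mul Nat.prime_two).1 h2 with h' | h'
    · exact hm h'
    · rw [mul_assoc] at h'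
      omega
  have h8 : ¬ 8 ∣ e := by
    intro h8e
    obtain ⟨k', hk'⟩ := h (2 * m)
      (coprime_one_add_mul_of_dvd (Dvd.intro (m * M) (by ring)) (dvd_mul_left _ _))
    have h2 : 2 ∣ m * (1 + 2 * k' * M) := by
      have := h8e.trans hk'
      rw [show 2 * (2 * m) * (1 + 2 * k' * M) = 4 * (m * (1 + 2 * k' * M)) by ring] at this
      omega
    rcases (Nat.Prime.dvd_mul Nat.prime_two).1 h2 with h' | h'
    · exact hm h'
    · rw [mul_assoc] at h'
      omega
  have he12 : e ∣ 12 := by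
    have : e ≤ 24 := Nat.le_of_dvd (by norm_num) he
    interval_cases e <;> omega
  refine ⟨he12, ?_⟩
  have hg : Nat.gcd e M ∣ 12 := (Nat.gcd_dvd_left _ _).trans he12
  have hg3 : ¬ 3 ∣ Nat.gcd e M := fun H =>
    h3 ⟨H.trans (Nat.gcd_dvd_left _ _), H.trans (Nat.gcd_dvd_right _ _)⟩
  have hg4 : ¬ 4 ∣ Nat.gcd e M := fun H =>
    h4 ⟨H.trans (Nat.gcd_dvd_left _ _),
      (Dvd.intro 2 rfl : 2 ∣ 4).trans (H.trans (Nat.gcd_dvd_right _ _))⟩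
  generalize Nat.gcd e M = g at *
  have : g ≤ 12 := Nat.le_of_dvd (by norm_num) hg
  interval_cases g <;> omega

/-- If `l` is coprime to `n`, it has an inverse modulo `n` that is congruent to one modulo every
number modulo which `l` is. -/
theorem exists_inverse_one_add_mul {n k M : ℕ} (hn : 0 < n) (h : (1 + k * M).Coprime n) :
    ∃ k' : ℕ, (1 + k * M) * (1 + k' * M) ≡ 1 [MOD n] := by
  have hφ := Nat.totient_pos.2 hn
  have h1 : 1 ≡ (1 + k * M) ^ (n.totient - 1) [MOD M] := by
    simpa using ((show 1 ≡ 1 + k * M [MOD M] by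
      simp [Nat.ModEq]).pow (n.totient - 1))
  obtain ⟨k', hk'⟩ := (Nat.modEq_iff_dvd' (Nat.one_le_pow _ _ (by omega))).1 h1
  refine ⟨k', ?_⟩
  have h2 : 1 + k' * M = (1 + k * M) ^ (n.totient - 1) := by
    have := Nat.one_le_pow (n.totient - 1) (1 + k * M) (by omega)
    rw [mul_comm k']
    omega
  rw [h2, ← pow_succ', Nat.sub_add_cancel hφ]
  exact Nat.ModEq.pow_totient h

/-- If `T ^ M` is the scalar `c`, the Galois-conjugated modular relation forces `g` to be the
inverse of a power of `c`. -/
theorem pow_smul_eq_one_of_galois_modular_relation {R A : Type*} [CommRing R] [Ring A]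
    [Algebra R A] {S T g : A} {c : R} {N M k k' : ℕ} (hS : IsUnit S) (hTN : T ^ N = 1)
    (hTM : T ^ M = c • (1 : A)) (hkk : (1 + k * M) * (1 + k' * M) ≡ 1 [MOD N])
    (hrel : T * S * T * S * T = S) (hSg : g * (S * g) = S)
    (hTg : T * g = g * T ^ (1 + k * M) ^ 2)
    (hrel' : T ^ (1 + k * M) * (S * g) * T ^ (1 + k * M) * (S * g) * T ^ (1 + k * M) = S * g) :
    c ^ (k + 2 * k') • g = 1 := by
  have hpow : ∀ j, T ^ (1 + j * M) = c ^ j • T := fun j => by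
    rw [pow_add, pow_one, mul_comm j, pow_mul, hTM, smul_pow, one_pow, mul_smul_comm, mul_one]
  have hTg' : ∀ j, T ^ j * g = g * T ^ ((1 + k * M) ^ 2 * j) := fun j => by
    rw [pow_mul]
    exact ((SemiconjBy.pow_right (show SemiconjBy g (T ^ (1 + k * M) ^ 2) T from hTg.symm) j)).symm
  have hmod : T ^ ((1 + k * M) ^ 2 * (1 + k' * M)) = T ^ (1 + k * M) := by
    have hmod' : (1 + k * M) ^ 2 * (1 + k' * M) ≡ 1 + k * M [MOD N] := by
      simpa [sq, mul_assoc] using hkk.mul_left (1 + k * M)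
    rw [pow_eq_pow_mod _ hTN, hmod', ← pow_eq_pow_mod _ hTN]
  have hcomm : g * T ^ (1 + k * M) = T ^ (1 + k' * M) * g := by rw [hTg', hmod]
  have h1 : T ^ (1 + k' * M) * S * T ^ (1 + k * M) * S * T ^ (1 + k' * M) * g = S := by
    calc _ = T ^ (1 + k' * M) * S * T ^ (1 + k * M) * S * (T ^ (1 + k' * M) * g) := by
            simp only [mul_assoc]
      _ = T ^ (1 + k' * M) * (g * (S * g)) * T ^ (1 + k * M) * S * (g * T ^ (1 + k * M)) := by
            rw [hSg, hcomm]
      _ = (T ^ (1 + k' * M) * g) * (S * g) * T ^ (1 + k * M) * (S * g) * T ^ (1 + k * M) := by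
            simp only [mul_assoc]
      _ = g * (T ^ (1 + k * M) * (S * g) * T ^ (1 + k * M) * (S * g) * T ^ (1 + k * M)) := by
            rw [← hcomm]; simp only [mul_assoc]
      _ = S := by rw [hrel', hSg]
  simp only [hpow, smul_mul_assoc, mul_smul_comm, smul_smul] at h1
  rw [hrel] at h1
  apply hS.mul_left_cancel
  rw [mul_smul_comm, mul_one]
  convert h1 using 2
  ring

theorem tM_sM_tM_sM_tM : tM * sM * tM * sM * tM = sM := by
  apply Subtype.ext
  change tM.1 * sM.1 * tM.1 * sM.1 * tM.1 = sM.1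
  simp [tM, sM]

theorem stmt5
    {I : Type} [Fintype I] [DecidableEq I] [Nonempty I] (i0 : I)
    (ρ : SL2Z →* (Matrix I I ℂ)ˣ)
    (S T : Matrix I I ℂ)
    (hSdef : S = (↑(ρ sM) : Matrix I I ℂ)) (hTdef : T = (↑(ρ tM) : Matrix I I ℂ))
    (n N : ℕ) (hn : 0 < n) (hNpos : 0 < N) (hNdvd : N ∣ n)
    (hTdiag : T.IsDiag) (hTord : orderOf T = N)
    (hSsymm : S.IsSymm) (hSunit : Sᴴ * S = 1)
    (ζ : ℂ) (hζ : ζ = Complex.exp (2 * Real.pi * Complex.I / n))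
    (hSfield : ∀ p q, S p q ∈ IntermediateField.adjoin ℚ {ζ})
    (perm : ℤ → Equiv.Perm I) (ε : ℤ → I → ℂ) (G : ℤ → Matrix I I ℂ)
    (hε : ∀ l : ℤ, IsCoprime l (n : ℤ) → ∀ p, ε l p = 1 ∨ ε l p = -1)
    (hG : ∀ (l : ℤ) (p q : I), G l p q = ε l q * (if p = perm l q then 1 else 0))
    (hGal : ∀ l : ℤ, IsCoprime l (n : ℤ) → ∀ σ : ℂ →+* ℂ, σ ζ = ζ ^ l →
      S.map σ = S * G l ∧ G l * S.map σ = S)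
    (hGT : ∀ l : ℤ, IsCoprime l (n : ℤ) → (G l)⁻¹ * T * G l = T ^ (l ^ 2 : ℤ))
    (hSpos : ∀ p, ∃ r : ℝ, 0 < r ∧ S i0 p = (r : ℂ))
    (N0 : ℕ) (hN0 : orderOf ((T i0 i0)⁻¹ • T) = N0) :
    N0 ∣ N ∧ N / N0 ∣ 12 ∧ (Nat.gcd (N / N0) N0 = 1 ∨ Nat.gcd (N / N0) N0 = 2) := by
  have hTN : T ^ N = 1 := hTord ▸ pow_orderOf_eq_one T
  have hdiag : diagonal T.diag = T := hTdiag.diagonal_diag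
  have hTpN : ∀ p, T p p ^ N = 1 := fun p => by
    have h := hTN
    rw [← hdiag, diagonal_pow] at h
    simpa using congrFun (congrFun h p) p
  have hω : T i0 i0 ≠ 0 := fun h => by
    have := hTpN i0
    rw [h, zero_pow hNpos.ne'] at this
    exact zero_ne_one this
  have hN0N : N0 ∣ N := by
    rw [← hN0]
    apply orderOf_dvd_of_pow_eq_one
    rw [smul_pow, hTN, inv_pow, hTpN, inv_one, one_smul]
  refine ⟨hN0N, ?_⟩
  obtain ⟨e, rfl⟩ := hN0N
  have hN0pos : 0 < N0 := Nat.pos_of_mul_pos_right hNpos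
  rw [Nat.mul_div_cancel_left _ hN0pos]
  set c : ℂ := T i0 i0 ^ N0 with hc
  have hc0 : c ≠ 0 := pow_ne_zero _ hω
  have hTN0 : T ^ N0 = c • (1 : Matrix I I ℂ) := by
    have h : ((T i0 i0)⁻¹ • T) ^ N0 = 1 := hN0 ▸ pow_orderOf_eq_one _
    rw [smul_pow, inv_pow] at h
    rw [← h, smul_smul, mul_inv_cancel₀ hc0, one_smul]
  have hce : ∀ j : ℕ, c ^ j = 1 → e ∣ j := fun j hj => by
    have h : T ^ (N0 * j) = 1 := by rw [pow_mul, hTN0, smul_pow, hj, one_pow, one_smul]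
    exact Nat.dvd_of_mul_dvd_mul_left hN0pos (hTord ▸ orderOf_dvd_of_pow_eq_one h)
  have hS : IsUnit S := hSdef ▸ (ρ sM).isUnit
  have hrel : T * S * T * S * T = S := by
    have h' := congrArg (fun x => ((ρ x : (Matrix I I ℂ)ˣ) : Matrix I I ℂ)) tM_sM_tM_sM_tM
    simpa [map_mul, ← hSdef, ← hTdef] using h'
  have : NeZero n := ⟨hn.ne'⟩
  have hζn : IsPrimitiveRoot ζ n := hζ ▸ Complex.isPrimitiveRoot_exp n hn.ne'
  have hgal : ∀ l : ℕ, l.Coprime n → ∃ g : Matrix I I ℂ, IsUnit g ∧ g * (S * g) = S ∧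
      T * g = g * T ^ l ^ 2 ∧ T ^ l * (S * g) * T ^ l * (S * g) * T ^ l = S * g ∧
      (g i0 i0 = 0 ∨ g i0 i0 ^ 2 = 1) := fun l hl => by
    have hl' : IsCoprime (l : ℤ) (n : ℤ) := Nat.isCoprime_iff_coprime.2 hl
    obtain ⟨σ, hσ⟩ := hζn.exists_ringHom_apply_eq_pow hn hl
    obtain ⟨h1, h2⟩ := hGal l hl' σ (by rw [hσ, zpow_natCast])
    have hσT : T.map σ = T ^ l := by
      rw [← hdiag, diagonal_pow, diagonal_map (map_zero σ)]
      congr 1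
      ext p
      have hp : T p p ^ n = 1 := by
        obtain ⟨d, rfl⟩ := hNdvd
        rw [pow_mul, hTpN, one_pow]
      obtain ⟨i, -, hi⟩ := hζn.eq_pow_of_pow_eq_one hp
      simp only [diag_apply, Pi.pow_apply]
      rw [← hi, map_pow, hσ, ← pow_mul, ← pow_mul, mul_comm]
    have hg : IsUnit (G l) := by
      rw [Matrix.isUnit_iff_isUnit_det] at hS ⊢
      rw [← h2, det_mul] at hS
      exact isUnit_of_mul_isUnit_left hS
    refine ⟨G l, hg, h1 ▸ h2, ?_, ?_, ?_⟩
    · have h3 := hGT l hl'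
      rw [show ((l : ℤ) ^ 2 : ℤ) = ((l ^ 2 : ℕ) : ℤ) by push_cast; rfl, zpow_natCast] at h3
      rw [← h3, ← mul_assoc, ← mul_assoc,
        mul_nonsing_inv _ ((Matrix.isUnit_iff_isUnit_det _).1 hg), one_mul]
    · have h3 := congrArg (fun X : Matrix I I ℂ => X.map σ) hrel
      simpa only [Matrix.map_mul, hσT, h1] using h3
    · rw [hG]
      rcases hε l hl' i0 with h | h <;> rw [h] <;> split_ifs <;> simp
  have h24 : e ∣ 24 := by
    refine dvd_twentyFour_of_forall_coprime_sq hn ((dvd_mul_left _ _).trans hNdvd) fun l hl => ?_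
    obtain ⟨g, hg, -, hTg, -, -⟩ := hgal l hl
    have h1 : T ^ N0 * g = g * (T ^ N0) ^ l ^ 2 := by
      rw [← pow_mul, mul_comm N0, pow_mul]
      exact ((SemiconjBy.pow_right
        (show SemiconjBy g (T ^ l ^ 2) T from hTg.symm) N0)).symm
    rw [hTN0, smul_pow, one_pow, smul_mul_assoc, mul_smul_comm, one_mul, mul_one] at h1
    have h2 : c = c ^ l ^ 2 := by
      refine smul_left_injective ℂ ?_ h1
      exact hg.ne_zero
    rcases Nat.eq_zero_or_pos l with rfl | hlpos
    · have hn1 : n = 1 := by simpa using hl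
      have : e ∣ 1 := hn1 ▸ (dvd_mul_left _ _).trans hNdvd
      rw [Nat.dvd_one.1 this]
      simp
    · have hl2 : 1 ≤ l ^ 2 := Nat.one_le_pow _ _ hlpos
      have h3 : c ^ (l ^ 2 - 1) = 1 := by
        apply mul_right_cancel₀ hc0
        rw [← pow_succ, Nat.sub_add_cancel hl2, ← h2, one_mul]
      have := Int.natCast_dvd_natCast.2 (hce _ h3)
      rwa [Nat.cast_sub hl2, Nat.cast_pow, Nat.cast_one] at this
  refine dvd_twelve_and_gcd_of_forall_dvd hn h24 fun k hk => ?_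
  obtain ⟨k', hkk⟩ := exists_inverse_one_add_mul hn hk
  refine ⟨k', ?_⟩
  replace hkk := hkk.of_dvd hNdvd
  obtain ⟨g, -, hSg, hTg, hrel', hg0⟩ := hgal _ hk
  have h1 : c ^ (2 * (k + 2 * k')) = 1 := by
    have h := congrArg (fun X : Matrix I I ℂ => X i0 i0)
      (pow_smul_eq_one_of_galois_modular_relation hS hTN hTN0 hkk hrel hSg hTg hrel')
    simp only [Matrix.smul_apply, one_apply_eq, smul_eq_mul] at h
    rcases hg0 with h0 | h0
    · simp [h0] at h
    · have h2 := congrArg (· ^ 2) h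
      simp only [mul_pow, h0, mul_one, one_pow, ← pow_mul] at h2
      rwa [mul_comm]
  have h2 : e ∣ k + k' + k * k' * N0 := by
    rw [show (1 + k * N0) * (1 + k' * N0) = 1 + N0 * (k + k' + k * k' * N0) by ring] at hkk
    have h3 := (Nat.modEq_iff_dvd' (Nat.le_add_right _ _)).1 hkk.symm
    rw [Nat.add_sub_cancel_left] at h3
    exact Nat.dvd_of_mul_dvd_mul_left hN0pos h3
  refine (Nat.dvd_add_right (hce _ h1)).1 ?_
  rw [show 2 * (k + 2 * k') + 2 * k * (1 + 2 * k' * N0) = 4 * (k + k' + k * k' * N0) by ring]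
  exact h2.mul_left 4
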